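/- Let d be a positive even integer with Clifford data γ₁, …, γ_d, γ₀ as in the context, and let y₁, …, y_{d+1} ∈ ℝ^d with y_{d+1} = 0. Then the function w ↦ tr( γ₀ ∏_{i=1}^{d} γ·( (y_i − w)^ − (y_{i+1} − w)^ ) ) is Lebesgue-integrable on ℝ^d and ∫_{ℝ^d} tr( γ₀ ∏_{i=1}^{d} γ·( (y_i − w)^ − (y_{i+1} − w)^ ) ) dw = Λ_d · Σ_{λ ∈ S_d} sgn(λ) ∏_{i=1}^{d} (y_i)_{λ_i}, where Λ_d = (2iπ)^{d/2} / (d/2)!. Equivalently, the integral equals Λ_d · det(y₁, …, y_d). -/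

import Mathlib

open scoped Classical
open MeasureTheory

/-- The normalization map: `v̂ = v/‖v‖` if `v ≠ 0`, and `0̂ = 0`. -/
noncomputable def unitHat {d : ℕ} (v : EuclideanSpace ℝ (Fin d)) : EuclideanSpace ℝ (Fin d) :=
  if v = 0 then 0 else ‖v‖⁻¹ • v

/-- `γ · v = Σ_j v_j γ_j`. -/
noncomputable def gammaDot {d n : ℕ} (γ : Fin d → Matrix (Fin n) (Fin n) ℂ)
    (v : EuclideanSpace ℝ (Fin d)) : Matrix (Fin n) (Fin n) ℂ :=
  ∑ j : Fin d, (v j : ℂ) • γ j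

/-- The grading `γ₀ = (−i)^{d/2} γ₁ ⋯ γ_d`. -/
noncomputable def gammaZero {d n : ℕ} (γ : Fin d → Matrix (Fin n) (Fin n) ℂ) :
    Matrix (Fin n) (Fin n) ℂ :=
  ((-Complex.I) ^ (d / 2)) • ((List.finRange d).map γ).prod

/-- The integrand `w ↦ tr(γ₀ ∏_{i=1}^d γ·((y_i − w)^ − (y_{i+1} − w)^))`. -/
noncomputable def cliffordIntegrand {d n : ℕ} (γ : Fin d → Matrix (Fin n) (Fin n) ℂ)
    (y : Fin (d + 1) → EuclideanSpace ℝ (Fin d)) (w : EuclideanSpace ℝ (Fin d)) : ℂ :=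
  Matrix.trace (gammaZero γ *
    ((List.finRange d).map (fun i : Fin d =>
      gammaDot γ (unitHat (y i.castSucc - w) - unitHat (y i.succ - w)))).prod)

/-- The constant `Λ_d = (2iπ)^{d/2} / (d/2)!`. -/
noncomputable def LambdaD (d : ℕ) : ℂ :=
  (2 * Complex.I * (Real.pi : ℂ)) ^ (d / 2) / (Nat.factorial (d / 2) : ℂ)

section Clifford

variable {d n : ℕ} {γ : Fin d → Matrix (Fin n) (Fin n) ℂ}

lemma clifford_sq (hγ : ∀ i j, γ i * γ j + γ j * γ i = (if i = j then (2 : ℂ) else 0) • 1)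
    (i : Fin d) : γ i * γ i = 1 := by
  have h := hγ i i
  rw [if_pos rfl, ← two_smul ℂ] at h
  exact smul_right_injective _ (two_ne_zero : (2 : ℂ) ≠ 0) h

lemma clifford_anticomm (hγ : ∀ i j, γ i * γ j + γ j * γ i = (if i = j then (2 : ℂ) else 0) • 1)
    {i j : Fin d} (hij : i ≠ j) : γ i * γ j = -(γ j * γ i) := by
  have h := hγ i j
  rw [if_neg hij, zero_smul] at h
  exact eq_neg_of_add_eq_zero_left h

/-- Moving a generator through a word in the generators. -/
lemma clifford_mul_word (hγ : ∀ i j, γ i * γ j + γ j * γ i = (if i = j then (2 : ℂ) else 0) • 1)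
    (j : Fin d) (l : List (Fin d)) :
    γ j * (l.map γ).prod = (-1 : ℂ) ^ (l.length + l.count j) • ((l.map γ).prod * γ j) := by
  induction l with
  | nil => simp
  | cons a t ih =>
    by_cases h : a = j
    · subst h
      rw [List.map_cons, List.prod_cons, List.length_cons, List.count_cons_self]
      nth_rewrite 1 [ih]
      rw [mul_smul_comm, ← mul_assoc]
      congr 1
      ring
    · rw [List.map_cons, List.prod_cons, List.length_cons, List.count_cons_of_ne h,
        ← mul_assoc, clifford_anticomm hγ (Ne.symm h), neg_mul, mul_assoc, ih, mul_smul_comm,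
        mul_assoc, ← neg_smul]
      congr 1
      ring

lemma clifford_word_sq (hγ : ∀ i j, γ i * γ j + γ j * γ i = (if i = j then (2 : ℂ) else 0) • 1)
    {l : List (Fin d)} (hl : l.Nodup) :
    (l.map γ).prod * (l.map γ).prod = (-1 : ℂ) ^ (l.length.choose 2) • 1 := by
  induction l with
  | nil => simp
  | cons a t ih =>
    rw [List.nodup_cons] at hl
    have h := clifford_mul_word hγ a t
    rw [List.count_eq_zero_of_not_mem hl.1, add_zero] at h
    have h' : (t.map γ).prod * γ a = (-1 : ℂ) ^ t.length • (γ a * (t.map γ).prod) := by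
      rw [h, smul_smul, ← mul_pow]
      simp
    rw [List.map_cons, List.prod_cons, mul_assoc, ← mul_assoc _ (γ a), h', smul_mul_assoc,
      mul_smul_comm, mul_assoc, ih hl.2, mul_smul_comm, mul_smul_comm, mul_one,
      clifford_sq hγ, smul_smul, ← pow_add, List.length_cons, Nat.choose_succ_succ' _ 1,
      Nat.choose_one_right]

lemma gammaZero_anticomm
    (hγ : ∀ i j, γ i * γ j + γ j * γ i = (if i = j then (2 : ℂ) else 0) • 1)
    (hd : Even d) (j : Fin d) : γ j * gammaZero γ = -(gammaZero γ * γ j) := by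
  have h1 : (List.finRange d).count j = 1 :=
    List.count_eq_one_of_mem (List.nodup_finRange d) (List.mem_finRange j)
  rw [gammaZero, mul_smul_comm, clifford_mul_word hγ, h1, List.length_finRange, pow_succ,
    hd.neg_one_pow, one_mul, neg_smul, one_smul, smul_neg, smul_mul_assoc]

/-- A word of even length missing some generator has vanishing graded trace. -/
lemma trace_gammaZero_word_eq_zero
    (hγ : ∀ i j, γ i * γ j + γ j * γ i = (if i = j then (2 : ℂ) else 0) • 1)
    (hd : Even d) {l : List (Fin d)} (hl : Even l.length) {j : Fin d} (hj : j ∉ l) :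
    Matrix.trace (gammaZero γ * (l.map γ).prod) = 0 := by
  have h := clifford_mul_word hγ j l
  rw [List.count_eq_zero_of_not_mem hj, add_zero, hl.neg_one_pow, one_smul] at h
  have key : Matrix.trace (gammaZero γ * (l.map γ).prod)
      = -Matrix.trace (gammaZero γ * (l.map γ).prod) := by
    calc Matrix.trace (gammaZero γ * (l.map γ).prod)
        = Matrix.trace (γ j * (γ j * (gammaZero γ * (l.map γ).prod))) := by
          rw [← mul_assoc, clifford_sq hγ, one_mul]
      _ = Matrix.trace (γ j * (gammaZero γ * (l.map γ).prod) * γ j) := Matrix.trace_mul_comm _ _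
      _ = -Matrix.trace (gammaZero γ * (l.map γ).prod) := by
          rw [← mul_assoc, gammaZero_anticomm hγ hd, neg_mul, neg_mul, mul_assoc (gammaZero γ), h,
            mul_assoc, mul_assoc, clifford_sq hγ, mul_one, Matrix.trace_neg]
  exact CharZero.eq_neg_self_iff.mp key

lemma clifford_prod_perm_mul_swap
    (hγ : ∀ i j, γ i * γ j + γ j * γ i = (if i = j then (2 : ℂ) else 0) • 1)
    (σ : Equiv.Perm (Fin d)) {i : ℕ} (hi : i + 1 < d) :
    ((List.finRange d).map fun k =>
        γ ((σ * Equiv.swap ⟨i, by omega⟩ ⟨i + 1, hi⟩ : Equiv.Perm (Fin d)) k)).prod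
      = -((List.finRange d).map fun k => γ (σ k)).prod := by
  have hsplit : List.finRange d = (List.finRange d).take i ++
      (⟨i, by omega⟩ : Fin d) :: ⟨i + 1, hi⟩ :: (List.finRange d).drop (i + 2) := by
    conv_lhs => rw [← List.take_append_drop i (List.finRange d)]
    rw [List.drop_eq_getElem_cons (by simp; omega), List.drop_eq_getElem_cons (by simp; omega)]
    simp
  have hfix : ∀ k : Fin d, (k : ℕ) ≠ i → (k : ℕ) ≠ i + 1 →
      (σ * Equiv.swap ⟨i, by omega⟩ ⟨i + 1, hi⟩ : Equiv.Perm (Fin d)) k = σ k := by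
    intro k h1 h2
    rw [Equiv.Perm.mul_apply, Equiv.swap_apply_of_ne_of_ne]
    · exact fun h => h1 (by rw [h])
    · exact fun h => h2 (by rw [h])
  have htake : ∀ k ∈ (List.finRange d).take i, (k : ℕ) < i := by
    intro k hk
    obtain ⟨m, hm, rfl⟩ := List.mem_iff_getElem.mp hk
    simp at hm ⊢
    omega
  have hdrop : ∀ k ∈ (List.finRange d).drop (i + 2), i + 2 ≤ (k : ℕ) := by
    intro k hk
    obtain ⟨m, hm, rfl⟩ := List.mem_iff_getElem.mp hk
    simp
  rw [hsplit]
  simp only [List.map_append, List.map_cons, List.prod_append, List.prod_cons]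
  rw [List.map_congr_left fun k hk => by
      rw [hfix k (by have := htake k hk; omega) (by have := htake k hk; omega)],
    List.map_congr_left (l := (List.finRange d).drop (i + 2)) fun k hk => by
      rw [hfix k (by have := hdrop k hk; omega) (by have := hdrop k hk; omega)]]
  rw [Equiv.Perm.mul_apply, Equiv.swap_apply_left, Equiv.Perm.mul_apply, Equiv.swap_apply_right,
    ← mul_assoc (γ _) (γ _), clifford_anticomm hγ (σ.injective.ne (by simp))]
  simp only [neg_mul, mul_neg, mul_assoc]

lemma clifford_prod_perm
    (hγ : ∀ i j, γ i * γ j + γ j * γ i = (if i = j then (2 : ℂ) else 0) • 1)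
    (σ : Equiv.Perm (Fin d)) :
    ((List.finRange d).map fun k => γ (σ k)).prod
      = ((Equiv.Perm.sign σ : ℤ) : ℂ) • ((List.finRange d).map γ).prod := by
  suffices H : ∀ τ σ : Equiv.Perm (Fin d),
      ((List.finRange d).map fun k => γ ((σ * τ : Equiv.Perm (Fin d)) k)).prod
        = ((Equiv.Perm.sign τ : ℤ) : ℂ) • ((List.finRange d).map fun k => γ (σ k)).prod by
    simpa using H σ 1
  obtain _ | m := d
  · intro τ σ
    simp [Subsingleton.elim τ 1]
  intro τ
  have hτ : τ ∈ Submonoid.closure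
      (Set.range fun i : Fin m => Equiv.swap i.castSucc i.succ) := by
    rw [Equiv.Perm.mclosure_swap_castSucc_succ]
    trivial
  induction hτ using Submonoid.closure_induction with
  | mem τ hτ =>
    obtain ⟨i, rfl⟩ := hτ
    intro σ
    rw [Equiv.Perm.sign_swap (Fin.castSucc_lt_succ).ne]
    rw [show ((Units.val (-1 : ℤˣ) : ℤ) : ℂ) = -1 by simp, neg_one_smul]
    exact clifford_prod_perm_mul_swap hγ σ (i := i) (by omega)
  | one => intro σ; simp
  | mul τ₁ τ₂ _ _ h₁ h₂ =>
    intro σ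
    rw [← mul_assoc, h₂, h₁, smul_smul, Equiv.Perm.sign_mul]
    push_cast
    rw [mul_comm]

lemma trace_gammaZero_mul_prod
    (hγ : ∀ i j, γ i * γ j + γ j * γ i = (if i = j then (2 : ℂ) else 0) • 1)
    (hd : Even d) (hn : n = 2 ^ (d / 2)) :
    Matrix.trace (gammaZero γ * ((List.finRange d).map γ).prod) = (2 * Complex.I) ^ (d / 2) := by
  obtain ⟨k, rfl⟩ := hd
  have hk : (k + k) / 2 = k := by omega
  rw [gammaZero, smul_mul_assoc, clifford_word_sq hγ (List.nodup_finRange _), List.length_finRange,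
    smul_smul, Matrix.trace_smul, Matrix.trace_one, Fintype.card_fin, hn, hk, smul_eq_mul]
  have hc : (k + k).choose 2 = k * (k + k - 1) := by
    rw [Nat.choose_two_right, ← two_mul, mul_assoc, Nat.mul_div_cancel_left _ two_pos]
  have hs : (-1 : ℂ) ^ (k + k).choose 2 = (-1) ^ k := by
    obtain _ | k := k
    · simp
    rw [hc, pow_mul]
    have : Odd (k + 1 + (k + 1) - 1) := ⟨k, by omega⟩
    rcases Nat.even_or_odd (k + 1) with h | h
    · rw [h.neg_one_pow, one_pow]
    · rw [h.neg_one_pow, this.neg_one_pow]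
  rw [hs]
  push_cast
  rw [← mul_pow, ← mul_pow]
  congr 1
  ring

/-- The graded trace of a product of `d` vectors is a multiple of their determinant. -/
lemma trace_gammaZero_mul_prod_gammaDot
    (hγ : ∀ i j, γ i * γ j + γ j * γ i = (if i = j then (2 : ℂ) else 0) • 1)
    (hd : Even d) (hn : n = 2 ^ (d / 2)) (a : Fin d → EuclideanSpace ℝ (Fin d)) :
    Matrix.trace (gammaZero γ * ((List.finRange d).map fun i => gammaDot γ (a i)).prod)
      = (2 * Complex.I) ^ (d / 2) *
        (((Matrix.of fun i j => a i j : Matrix (Fin d) (Fin d) ℝ).det : ℝ) : ℂ) := by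
  have hexp : ((List.finRange d).map fun i => gammaDot γ (a i)).prod
      = ∑ f : Fin d → Fin d, (∏ i, (a i (f i) : ℂ)) •
          ((List.finRange d).map fun i => γ (f i)).prod := by
    have h := (MultilinearMap.mkPiAlgebraFin ℂ d (Matrix (Fin n) (Fin n) ℂ)).map_sum
      (fun i j => (a i j : ℂ) • γ j)
    simp only [MultilinearMap.map_smul_univ, MultilinearMap.mkPiAlgebraFin_apply,
      List.ofFn_eq_map] at h
    exact h
  rw [hexp, Finset.mul_sum, Matrix.trace_sum, ← Matrix.det_transpose, Matrix.det_apply']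
  simp only [mul_smul_comm, Matrix.trace_smul, smul_eq_mul]
  have hsub := Finset.sum_subset (Finset.filter_subset (fun f : Fin d → Fin d => f.Bijective)
    Finset.univ) (f := fun f => (∏ i, (a i (f i) : ℂ)) *
      Matrix.trace (gammaZero γ * ((List.finRange d).map fun i => γ (f i)).prod)) (by
    intro f _ hf
    have hf' : ¬ Function.Surjective f := fun h =>
      hf (Finset.mem_filter.2 ⟨Finset.mem_univ _, h.bijective_of_finite⟩)
    simp only [Function.Surjective, not_forall, not_exists] at hf'
    obtain ⟨j, hj⟩ := hf'
    have h := trace_gammaZero_word_eq_zero hγ hd (l := (List.finRange d).map f)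
      (by simpa using hd) (j := j) (by simpa using hj)
    rw [List.map_map] at h
    simp only [Function.comp_def] at h
    rw [h, mul_zero])
  rw [← hsub, Complex.ofReal_sum, Finset.mul_sum]
  refine Finset.sum_bij (fun p h ↦ Equiv.ofBijective p (Finset.mem_filter.1 h).2)
    (fun _ _ ↦ Finset.mem_univ _) (fun _ _ _ _ h ↦ by injection h)
    (fun b _ ↦ ⟨b, Finset.mem_filter.2 ⟨Finset.mem_univ _, b.bijective⟩, Equiv.coe_fn_injective rfl⟩)
    ?_
  intro f hf
  have hp := clifford_prod_perm hγ (Equiv.ofBijective f (Finset.mem_filter.1 hf).2)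
  simp only [Equiv.ofBijective_apply] at hp
  rw [hp, mul_smul_comm, Matrix.trace_smul, trace_gammaZero_mul_prod hγ hd hn]
  simp only [Matrix.transpose_apply, Matrix.of_apply, Equiv.ofBijective_apply, smul_eq_mul]
  push_cast
  ring

end Clifford

section NullLagrangian

variable {d : ℕ}

/-- The Jacobian matrix of a family of `d` functions on `ℝ^d`. -/
noncomputable def gradMatrix (f : Fin d → EuclideanSpace ℝ (Fin d) → ℝ)
    (w : EuclideanSpace ℝ (Fin d)) : Matrix (Fin d) (Fin d) ℝ :=
  Matrix.of fun i j => fderiv ℝ (f i) w (EuclideanSpace.single j 1)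

lemma gradMatrix_apply (f : Fin d → EuclideanSpace ℝ (Fin d) → ℝ)
    (w : EuclideanSpace ℝ (Fin d)) (i j : Fin d) :
    gradMatrix f w i j = fderiv ℝ (f i) w (EuclideanSpace.single j 1) := rfl

lemma contDiff_partial {f : EuclideanSpace ℝ (Fin d) → ℝ} (hf : ContDiff ℝ 2 f)
    (v : EuclideanSpace ℝ (Fin d)) : ContDiff ℝ 1 fun w => fderiv ℝ f w v :=
  (hf.fderiv_right (m := 1) (by norm_num)).clm_apply contDiff_const

lemma continuous_det_gradMatrix {f : Fin d → EuclideanSpace ℝ (Fin d) → ℝ}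
    (hf : ∀ i, ContDiff ℝ 2 (f i)) : Continuous fun w => (gradMatrix f w).det :=
  Continuous.matrix_det <| continuous_matrix fun i _ => (contDiff_partial (hf i) _).continuous

lemma det_gradMatrix_eq_sum (f : Fin d → EuclideanSpace ℝ (Fin d) → ℝ) (k : Fin d)
    (w : EuclideanSpace ℝ (Fin d)) :
    (gradMatrix f w).det = ∑ σ : Equiv.Perm (Fin d), ((Equiv.Perm.sign σ : ℤ) : ℝ) *
      (fderiv ℝ (f k) w (EuclideanSpace.single (σ k) 1) *
        ∏ i ∈ Finset.univ.erase k, fderiv ℝ (f i) w (EuclideanSpace.single (σ i) 1)) := by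
  rw [← Matrix.det_transpose, Matrix.det_apply']
  refine Finset.sum_congr rfl fun σ _ => ?_
  rw [← Finset.mul_prod_erase _ _ (Finset.mem_univ k)]
  rfl

/-- The cofactor rows of a Jacobian matrix are divergence free. -/
lemma sum_sign_mul_fderiv_prod_eq_zero {f : Fin d → EuclideanSpace ℝ (Fin d) → ℝ}
    (hf : ∀ i, ContDiff ℝ 2 (f i)) (k : Fin d) (w : EuclideanSpace ℝ (Fin d)) :
    ∑ σ : Equiv.Perm (Fin d), ((Equiv.Perm.sign σ : ℤ) : ℝ) *
      fderiv ℝ (fun w => ∏ i ∈ Finset.univ.erase k,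
        fderiv ℝ (f i) w (EuclideanSpace.single (σ i) 1)) w (EuclideanSpace.single (σ k) 1)
      = 0 := by
  have hder : ∀ σ : Equiv.Perm (Fin d),
      fderiv ℝ (fun w => ∏ i ∈ Finset.univ.erase k,
        fderiv ℝ (f i) w (EuclideanSpace.single (σ i) 1)) w (EuclideanSpace.single (σ k) 1)
      = ∑ l ∈ Finset.univ.erase k, (∏ i ∈ (Finset.univ.erase k).erase l,
          fderiv ℝ (f i) w (EuclideanSpace.single (σ i) 1)) *
          fderiv ℝ (fderiv ℝ (f l)) w (EuclideanSpace.single (σ k) 1)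
            (EuclideanSpace.single (σ l) 1) := by
    intro σ
    have h2 : ∀ i, DifferentiableAt ℝ (fderiv ℝ (f i)) w := fun i =>
      ((hf i).fderiv_right (m := 1) (by norm_num)).differentiable (by norm_num) w
    rw [(HasFDerivAt.finsetProd fun i _ =>
      ((h2 i).hasFDerivAt.clm_apply (hasFDerivAt_const _ _))).fderiv]
    simp
  simp only [hder, Finset.mul_sum]
  rw [Finset.sum_comm]
  refine Finset.sum_eq_zero fun l hl => ?_
  have hlk : l ≠ k := (Finset.mem_erase.mp hl).1
  rw [← CharZero.eq_neg_self_iff, ← Finset.sum_neg_distrib]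
  refine Fintype.sum_equiv (Equiv.mulRight (Equiv.swap k l)) _ _ fun σ => ?_
  have hprod : ∏ i ∈ (Finset.univ.erase k).erase l, fderiv ℝ (f i) w
        (EuclideanSpace.single ((σ * Equiv.swap k l : Equiv.Perm (Fin d)) i) 1)
      = ∏ i ∈ (Finset.univ.erase k).erase l,
          fderiv ℝ (f i) w (EuclideanSpace.single (σ i) 1) := by
    refine Finset.prod_congr rfl fun i hi => ?_
    simp only [Finset.mem_erase, Finset.mem_univ, and_true] at hi
    rw [Equiv.Perm.mul_apply, Equiv.swap_apply_of_ne_of_ne hi.2 hi.1]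
  have hsymm : IsSymmSndFDerivAt ℝ (f l) w := (hf l).contDiffAt.isSymmSndFDerivAt (by simp)
  rw [Equiv.coe_mulRight, hprod, Equiv.Perm.mul_apply, Equiv.Perm.mul_apply,
    Equiv.swap_apply_left, Equiv.swap_apply_right, Equiv.Perm.sign_mul,
    Equiv.Perm.sign_swap hlk.symm, hsymm.eq]
  push_cast
  ring

/-- The Jacobian determinant is a null Lagrangian. -/
lemma integral_det_gradMatrix_eq_zero_of_hasCompactSupport
    {f : Fin d → EuclideanSpace ℝ (Fin d) → ℝ} (hf : ∀ i, ContDiff ℝ 2 (f i)) {k : Fin d}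
    (hk : HasCompactSupport (f k)) : ∫ w, (gradMatrix f w).det = 0 := by
  set P : Equiv.Perm (Fin d) → EuclideanSpace ℝ (Fin d) → ℝ := fun σ w =>
    ∏ i ∈ Finset.univ.erase k, fderiv ℝ (f i) w (EuclideanSpace.single (σ i) 1) with hP
  have hPc : ∀ σ, ContDiff ℝ 1 (P σ) := fun σ => contDiff_prod fun i _ => contDiff_partial (hf i) _
  have hfk : Continuous (f k) := (hf k).continuous
  have hdfk : ∀ v, Continuous fun w => fderiv ℝ (f k) w v := fun v =>
    (contDiff_partial (hf k) v).continuous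
  have hdP : ∀ σ v, Continuous fun w => fderiv ℝ (P σ) w v := fun σ v =>
    ((hPc σ).continuous_fderiv (by norm_num)).clm_apply continuous_const
  have hdk : ∀ v, HasCompactSupport fun w => fderiv ℝ (f k) w v := fun v => hk.fderiv_apply ℝ v
  have i1 : ∀ σ v, Integrable fun w => fderiv ℝ (f k) w v * P σ w := fun σ v =>
    ((hdfk v).mul (hPc σ).continuous).integrable_of_hasCompactSupport (hdk v).mul_right
  have i2 : ∀ σ v, Integrable fun w => f k w * fderiv ℝ (P σ) w v := fun σ v =>
    (hfk.mul (hdP σ v)).integrable_of_hasCompactSupport hk.mul_right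
  have i3 : ∀ σ, Integrable fun w => f k w * P σ w := fun σ =>
    (hfk.mul (hPc σ).continuous).integrable_of_hasCompactSupport hk.mul_right
  have hparts : ∀ σ v, ∫ w, fderiv ℝ (f k) w v * P σ w = -∫ w, f k w * fderiv ℝ (P σ) w v := by
    intro σ v
    rw [integral_mul_fderiv_eq_neg_fderiv_mul_of_integrable (i1 σ v) (i2 σ v) (i3 σ)
      (fun x _ => (hf k).differentiable (by norm_num) x)
      (fun x _ => (hPc σ).differentiable (by norm_num) x), neg_neg]
  simp only [det_gradMatrix_eq_sum f k]
  rw [integral_finsetSum _ fun σ _ => (i1 σ _).const_mul _]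
  simp only [integral_const_mul]
  rw [Finset.sum_congr rfl fun σ _ => by
    rw [hparts σ, mul_neg, ← integral_const_mul]]
  rw [Finset.sum_neg_distrib, ← integral_finsetSum _ fun σ _ => (i2 σ _).const_mul _,
    neg_eq_zero]
  refine integral_eq_zero_of_ae (Filter.Eventually.of_forall fun w => ?_)
  have h := congrArg (f k w * ·) (sum_sign_mul_fderiv_prod_eq_zero hf k w)
  simp only [Finset.mul_sum, mul_zero] at h
  rw [Pi.zero_apply, ← h]
  exact Finset.sum_congr rfl fun σ _ => by simp only [hP]; ring

end NullLagrangian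

section Decay

variable {d : ℕ}

lemma gradMatrix_mulVec (f : Fin d → EuclideanSpace ℝ (Fin d) → ℝ)
    (w v : EuclideanSpace ℝ (Fin d)) (i : Fin d) :
    (gradMatrix f w).mulVec v.ofLp i = fderiv ℝ (f i) w v := by
  conv_rhs => rw [← (EuclideanSpace.basisFun (Fin d) ℝ).sum_repr v, map_sum]
  simp [Matrix.mulVec, dotProduct, gradMatrix_apply, mul_comm]

lemma gradMatrix_update (f : Fin d → EuclideanSpace ℝ (Fin d) → ℝ) (k : Fin d)
    (h : EuclideanSpace ℝ (Fin d) → ℝ) (w : EuclideanSpace ℝ (Fin d)) :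
    gradMatrix (Function.update f k h) w
      = (gradMatrix f w).updateRow k fun j => fderiv ℝ h w (EuclideanSpace.single j 1) := by
  ext i j
  by_cases hi : i = k
  · subst hi
    simp [gradMatrix_apply]
  · simp [gradMatrix_apply, hi]

lemma abs_det_le_factorial_mul_prod {M : Matrix (Fin d) (Fin d) ℝ} {B : Fin d → ℝ}
    (h : ∀ i j, |M i j| ≤ B i) : |M.det| ≤ d.factorial * ∏ i, B i := by
  rw [← Matrix.det_transpose, Matrix.det_apply']
  refine (Finset.abs_sum_le_sum_abs _ _).trans ?_
  have hb : ∀ σ ∈ (Finset.univ : Finset (Equiv.Perm (Fin d))),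
      |((Equiv.Perm.sign σ : ℤ) : ℝ) * ∏ i, M.transpose (σ i) i| ≤ ∏ i, B i := by
    intro σ _
    have hσ : |((Equiv.Perm.sign σ : ℤ) : ℝ)| = 1 := by
      rcases Int.units_eq_one_or (Equiv.Perm.sign σ) with h | h <;> simp [h]
    rw [abs_mul, hσ, one_mul, Finset.abs_prod]
    exact Finset.prod_le_prod (fun _ _ => abs_nonneg _) fun i _ => h i (σ i)
  refine (Finset.sum_le_card_nsmul _ _ _ hb).trans_eq ?_
  rw [Finset.card_univ, Fintype.card_perm, Fintype.card_fin, nsmul_eq_mul]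

/-- A matrix with entries of size `1 / (1 + ‖w‖)` which nearly annihilates `w` has a determinant
of size `1 / (1 + ‖w‖) ^ (d + 1)`. -/
lemma pow_mul_abs_det_le {M : Matrix (Fin d) (Fin d) ℝ} {w : EuclideanSpace ℝ (Fin d)} {K : ℝ}
    (hK : 1 ≤ K) (h₁ : ∀ i j, (1 + ‖w‖) * |M i j| ≤ K)
    (h₂ : ∀ i, (1 + ‖w‖) * |M.mulVec w.ofLp i| ≤ K) :
    (1 + ‖w‖) ^ (d + 1) * |M.det| ≤ d.factorial * K ^ d * (1 + d * (d * K)) := by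
  set t := 1 + ‖w‖ with ht
  have ht0 : 0 < t := by positivity
  set N := t • M with hN
  have hNe : ∀ i j, |N i j| ≤ K := fun i j => by
    rw [hN, Matrix.smul_apply, smul_eq_mul, abs_mul, abs_of_pos ht0]
    exact h₁ i j
  have hNd : |N.det| ≤ d.factorial * K ^ d := by
    simpa using abs_det_le_factorial_mul_prod (B := fun _ => K) hNe
  have hadj : ∀ i j, |N.adjugate i j| ≤ d.factorial * K ^ d := by
    intro i j
    rw [Matrix.adjugate_apply]
    refine (abs_det_le_factorial_mul_prod (B := fun _ => K) fun a b => ?_).trans_eq (by simp)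
    by_cases ha : a = j
    · subst ha
      rw [Matrix.updateRow_self, Pi.single_apply]
      split_ifs <;> simp <;> linarith
    · rw [Matrix.updateRow_ne ha]
      exact hNe a b
  have hcoord : ∀ j, |N.det| * |w j| ≤ d * (d.factorial * K ^ d * K) := by
    intro j
    have h : N.det * w j = ∑ i, N.adjugate j i * N.mulVec w.ofLp i := by
      have h : N.adjugate.mulVec (N.mulVec w.ofLp) = N.det • w.ofLp := by
        rw [Matrix.mulVec_mulVec, Matrix.adjugate_mul, Matrix.smul_mulVec, Matrix.one_mulVec]
      exact (congrFun h j).symm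
    rw [← abs_mul, h]
    refine (Finset.abs_sum_le_sum_abs _ _).trans ?_
    refine (Finset.sum_le_card_nsmul _ _ (d.factorial * K ^ d * K) fun i _ => ?_).trans_eq
      (by simp)
    rw [abs_mul]
    refine mul_le_mul (hadj j i) ?_ (abs_nonneg _) (by positivity)
    rw [hN, Matrix.smul_mulVec, Pi.smul_apply, smul_eq_mul, abs_mul, abs_of_pos ht0]
    exact h₂ i
  have hnorm : ‖w‖ ≤ ∑ j, |w j| := by
    conv_lhs => rw [← (EuclideanSpace.basisFun (Fin d) ℝ).sum_repr w]
    refine (norm_sum_le _ _).trans (Finset.sum_le_sum fun j _ => ?_)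
    simp [norm_smul]
  have hdet : N.det = t ^ d * M.det := by simp [hN]
  calc t ^ (d + 1) * |M.det| = |N.det| + |N.det| * ‖w‖ := by
        rw [hdet, abs_mul, abs_of_pos (pow_pos ht0 d), ht]
        ring
    _ ≤ |N.det| + |N.det| * ∑ j, |w j| := by gcongr
    _ ≤ d.factorial * K ^ d + d * (d * (d.factorial * K ^ d * K)) := by
        refine add_le_add hNd ?_
        rw [Finset.mul_sum]
        exact (Finset.sum_le_card_nsmul _ _ _ fun j _ => hcoord j).trans_eq (by simp)
    _ = d.factorial * K ^ d * (1 + d * (d * K)) := by ring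

lemma integrable_inv_one_add_norm_pow :
    Integrable fun w : EuclideanSpace ℝ (Fin d) => ((1 + ‖w‖) ^ (d + 1))⁻¹ := by
  have h := integrable_one_add_norm (E := EuclideanSpace ℝ (Fin d)) (μ := volume)
    (r := ((d + 1 : ℕ) : ℝ)) (by simp)
  refine h.congr (Filter.Eventually.of_forall fun w => ?_)
  simp only
  rw [Real.rpow_neg (by positivity), Real.rpow_natCast]

/-- Twice continuously differentiable functions whose gradient is `O(1 / ‖w‖)`, with a radial part
that is even `O(1 / ‖w‖ ^ 2)`. -/
structure Tame (f : EuclideanSpace ℝ (Fin d) → ℝ) : Prop where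
  contDiff : ContDiff ℝ 2 f
  bound : ∃ C, ∀ w, (1 + ‖w‖) * ‖fderiv ℝ f w‖ ≤ C ∧ (1 + ‖w‖) * |fderiv ℝ f w w| ≤ C

lemma Tame.sub {f g : EuclideanSpace ℝ (Fin d) → ℝ} (hf : Tame f) (hg : Tame g) :
    Tame fun w => f w - g w := by
  obtain ⟨C, hC⟩ := hf.bound
  obtain ⟨D, hD⟩ := hg.bound
  refine ⟨hf.contDiff.sub hg.contDiff, C + D, fun w => ?_⟩
  have hw : 0 ≤ 1 + ‖w‖ := by positivity
  rw [fderiv_fun_sub (hf.contDiff.differentiable (by norm_num) w)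
    (hg.contDiff.differentiable (by norm_num) w), sub_apply]
  constructor
  · refine (mul_le_mul_of_nonneg_left (norm_sub_le _ _) hw).trans ?_
    rw [mul_add]
    exact add_le_add (hC w).1 (hD w).1
  · refine (mul_le_mul_of_nonneg_left (abs_sub _ _) hw).trans ?_
    rw [mul_add]
    exact add_le_add (hC w).2 (hD w).2

lemma exists_tame_bound {f : Fin d → EuclideanSpace ℝ (Fin d) → ℝ} (hf : ∀ i, Tame (f i)) :
    ∃ K, 1 ≤ K ∧ ∀ w, (∀ i j, (1 + ‖w‖) * |gradMatrix f w i j| ≤ K) ∧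
      ∀ i, (1 + ‖w‖) * |(gradMatrix f w).mulVec w.ofLp i| ≤ K := by
  choose C hC using fun i => (hf i).bound
  have hle : ∀ i, C i ≤ 1 + ∑ i, |C i| := fun i =>
    (le_abs_self _).trans <| (Finset.single_le_sum (f := fun i => |C i|)
      (fun i _ => abs_nonneg _) (Finset.mem_univ i)).trans (by simp)
  refine ⟨1 + ∑ i, |C i|, by simp; positivity, fun w => ⟨fun i j => ?_, fun i => ?_⟩⟩
  · refine le_trans ?_ ((hC i w).1.trans (hle i))
    gcongr
    rw [gradMatrix_apply, ← Real.norm_eq_abs]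
    exact (ContinuousLinearMap.le_opNorm _ _).trans_eq (by simp)
  · rw [gradMatrix_mulVec]
    exact (hC i w).2.trans (hle i)

lemma integrable_det_gradMatrix {f : Fin d → EuclideanSpace ℝ (Fin d) → ℝ}
    (hf : ∀ i, Tame (f i)) : Integrable fun w => (gradMatrix f w).det := by
  obtain ⟨K, hK, hb⟩ := exists_tame_bound hf
  refine (integrable_inv_one_add_norm_pow.const_mul
    (d.factorial * K ^ d * (1 + d * (d * K)))).mono'
    (continuous_det_gradMatrix fun i => (hf i).contDiff).aestronglyMeasurable
    (Filter.Eventually.of_forall fun w => ?_)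
  rw [Real.norm_eq_abs, ← div_eq_mul_inv, le_div_iff₀' (by positivity)]
  exact pow_mul_abs_det_le hK (hb w).1 (hb w).2

end Decay

section Cutoff

variable {d : ℕ}

/-- A sequence of cutoff functions exhausting the space, with controlled gradients. -/
lemma exists_cutoff (d : ℕ) : ∃ (χ : ℕ → EuclideanSpace ℝ (Fin d) → ℝ) (C : ℝ),
    (∀ m, ContDiff ℝ 2 (χ m)) ∧ (∀ m, HasCompactSupport (χ m)) ∧ (∀ m w, |χ m w| ≤ 1) ∧
    (∀ w, Filter.Tendsto (fun m => χ m w) Filter.atTop (nhds 1)) ∧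
    ∀ m w, (m + 1 + ‖w‖) * ‖fderiv ℝ (χ m) w‖ ≤ C := by
  let b : ContDiffBump (0 : EuclideanSpace ℝ (Fin d)) := ⟨1, 2, by norm_num, by norm_num⟩
  have hb : ContDiff ℝ 2 b := b.contDiff
  have hbc : HasCompactSupport b := b.hasCompactSupport
  have hscale : ∀ m : ℕ, ((m : ℝ) + 1)⁻¹ ≠ 0 := fun m => by positivity
  have hψ : Continuous fun w => (1 + ‖w‖) * ‖fderiv ℝ b w‖ :=
    (continuous_const.add continuous_norm).mul (hb.continuous_fderiv (by norm_num)).norm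
  obtain ⟨C, hC⟩ := hψ.bounded_above_of_compact_support
    (((hbc.fderiv ℝ).norm).mul_left)
  refine ⟨fun m w => b (((m : ℝ) + 1)⁻¹ • w), C, fun m => hb.comp (contDiff_const_smul _),
    fun m => hbc.comp_smul (hscale m), fun m w => ?_, fun w => ?_, fun m w => ?_⟩
  · rw [abs_of_nonneg b.nonneg]
    exact b.le_one
  · have h0 : Filter.Tendsto (fun m : ℕ => ((m : ℝ) + 1)⁻¹ • w) Filter.atTop (nhds 0) := by
      have := (tendsto_one_div_add_atTop_nhds_zero_nat (𝕜 := ℝ)).smul_const w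
      simpa [one_div] using this
    have h1 := (b.continuous.tendsto 0).comp h0
    have hb0 : b 0 = 1 := b.one_of_mem_closedBall (by simp [b])
    rwa [hb0] at h1
  · have hder : HasFDerivAt (fun w => b (((m : ℝ) + 1)⁻¹ • w))
        ((fderiv ℝ b (((m : ℝ) + 1)⁻¹ • w)).comp
          (((m : ℝ) + 1)⁻¹ • ContinuousLinearMap.id ℝ (EuclideanSpace ℝ (Fin d)))) w :=
      HasFDerivAt.comp (g := (b : EuclideanSpace ℝ (Fin d) → ℝ)) w
        (hb.differentiable (by norm_num) _).hasFDerivAt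
        (((m : ℝ) + 1)⁻¹ • ContinuousLinearMap.id ℝ (EuclideanSpace ℝ (Fin d))).hasFDerivAt
    rw [hder.fderiv, ContinuousLinearMap.comp_smul, ContinuousLinearMap.comp_id, norm_smul]
    have h := hC (((m : ℝ) + 1)⁻¹ • w)
    have hm : (0 : ℝ) < m + 1 := by positivity
    rw [norm_mul, norm_norm, Real.norm_eq_abs, abs_of_nonneg (by positivity), norm_smul, norm_inv,
      Real.norm_eq_abs, abs_of_pos hm] at h
    rw [norm_inv, Real.norm_eq_abs, abs_of_pos hm]
    refine le_trans (le_of_eq ?_) h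
    field_simp

/-- Integrals of Jacobian determinants of tame functions vanish as soon as one of the functions
decays at infinity. -/
lemma integral_det_gradMatrix_eq_zero {f : Fin d → EuclideanSpace ℝ (Fin d) → ℝ}
    (hf : ∀ i, Tame (f i)) {k : Fin d} {D : ℝ} (hk : ∀ w, (1 + ‖w‖) * |f k w| ≤ D) :
    ∫ w, (gradMatrix f w).det = 0 := by
  obtain ⟨K, hK, hb⟩ := exists_tame_bound hf
  obtain ⟨χ, C, hχ, hχc, hχ1, hχt, hχd⟩ := exists_cutoff d
  have hC : 0 ≤ C := le_trans (by positivity) (hχd 0 0)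
  have hD : 0 ≤ D := le_trans (by positivity) (hk 0)
  set g : ℕ → Fin d → EuclideanSpace ℝ (Fin d) → ℝ := fun m =>
    Function.update f k fun w => χ m w * f k w with hg
  have hgc : ∀ m i, ContDiff ℝ 2 (g m i) := by
    intro m i
    by_cases hi : i = k
    · subst hi
      simpa [hg] using (hχ m).mul (hf i).contDiff
    · simpa [hg, hi] using (hf i).contDiff
  have hzero : ∀ m, ∫ w, (gradMatrix (g m) w).det = 0 := fun m =>
    integral_det_gradMatrix_eq_zero_of_hasCompactSupport (hgc m) (k := k)
      (by simp only [hg, Function.update_self]; exact (hχc m).mul_right)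
  set R : ℕ → EuclideanSpace ℝ (Fin d) → Matrix (Fin d) (Fin d) ℝ := fun m w =>
    (gradMatrix f w).updateRow k fun j => fderiv ℝ (χ m) w (EuclideanSpace.single j 1) with hR
  have hsplit : ∀ m w, (gradMatrix (g m) w).det
      = χ m w * (gradMatrix f w).det + f k w * (R m w).det := by
    intro m w
    have hrow : (fun j => fderiv ℝ (fun w => χ m w * f k w) w (EuclideanSpace.single j 1))
        = χ m w • gradMatrix f w k +
          f k w • fun j => fderiv ℝ (χ m) w (EuclideanSpace.single j 1) := by
      ext j
      rw [fderiv_fun_mul ((hχ m).differentiable (by norm_num) w)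
        ((hf k).contDiff.differentiable (by norm_num) w)]
      simp [gradMatrix_apply]
    rw [hg, gradMatrix_update, hrow, Matrix.det_updateRow_add, Matrix.det_updateRow_smul,
      Matrix.det_updateRow_smul, Matrix.updateRow_eq_self]
  set A : ℝ := D * (d.factorial * (C * K ^ (d - 1))) with hA
  have hA0 : 0 ≤ A := by positivity
  have hRb : ∀ m w, |f k w * (R m w).det| ≤ A * ((1 + ‖w‖) ^ d)⁻¹ * (m + 1 + ‖w‖)⁻¹ := by
    intro m w
    have ht : 0 < 1 + ‖w‖ := by positivity
    have hs : 0 < (m : ℝ) + 1 + ‖w‖ := by positivity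
    have hdet := abs_det_le_factorial_mul_prod (M := R m w)
      (B := Function.update (fun _ => K * (1 + ‖w‖)⁻¹) k (C * (m + 1 + ‖w‖)⁻¹)) (by
        intro i j
        by_cases hi : i = k
        · subst hi
          simp only [hR, Matrix.updateRow_self, Function.update_self]
          rw [← div_eq_mul_inv, le_div_iff₀' hs]
          refine le_trans (mul_le_mul_of_nonneg_left ?_ hs.le) (hχd m w)
          rw [← Real.norm_eq_abs]
          exact (ContinuousLinearMap.le_opNorm _ _).trans_eq (by simp)
        · simp only [hR, Matrix.updateRow_ne hi, Function.update_of_ne hi]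
          rw [← div_eq_mul_inv, le_div_iff₀' ht]
          exact (hb w).1 i j)
    rw [Finset.prod_update_of_mem (Finset.mem_univ k), Finset.prod_const, Finset.card_sdiff,
      Finset.inter_univ, Finset.card_singleton, Finset.card_univ, Fintype.card_fin] at hdet
    have hfk : |f k w| ≤ D * (1 + ‖w‖)⁻¹ := by
      rw [← div_eq_mul_inv, le_div_iff₀' ht]
      exact hk w
    rw [abs_mul]
    refine (mul_le_mul hfk hdet (abs_nonneg _) (by positivity)).trans_eq ?_
    obtain ⟨e, he⟩ : ∃ e, d = e + 1 := ⟨d - 1, by have := k.pos; omega⟩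
    have hpow : ((1 + ‖w‖) ^ d)⁻¹ = (1 + ‖w‖)⁻¹ * ((1 + ‖w‖)⁻¹) ^ (d - 1) := by
      rw [← pow_succ', Nat.sub_add_cancel k.pos, inv_pow]
    rw [hA, hpow, mul_pow]
    ring
  have hlim : Filter.Tendsto (fun m => ∫ w, (gradMatrix (g m) w).det) Filter.atTop
      (nhds (∫ w, (gradMatrix f w).det)) := by
    refine tendsto_integral_of_dominated_convergence
      (fun w => |(gradMatrix f w).det| + A * ((1 + ‖w‖) ^ (d + 1))⁻¹)
      (fun m => (continuous_det_gradMatrix (hgc m)).aestronglyMeasurable)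
      ((integrable_det_gradMatrix hf).abs.add (integrable_inv_one_add_norm_pow.const_mul A))
      (fun m => Filter.Eventually.of_forall fun w => ?_)
      (Filter.Eventually.of_forall fun w => ?_)
    · rw [hsplit, Real.norm_eq_abs]
      refine (abs_add_le _ _).trans (add_le_add ?_ ((hRb m w).trans ?_))
      · rw [abs_mul]
        exact mul_le_of_le_one_left (abs_nonneg _) (hχ1 m w)
      · rw [pow_succ, mul_inv, ← mul_assoc]
        gcongr
        have : (0 : ℝ) ≤ m := by positivity
        linarith
    · simp only [hsplit]
      have h1 := (hχt w).mul_const (gradMatrix f w).det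
      have h2 : Filter.Tendsto (fun m => f k w * (R m w).det) Filter.atTop (nhds 0) := by
        have h3 := (tendsto_one_div_add_atTop_nhds_zero_nat (𝕜 := ℝ)).const_mul
          (A * ((1 + ‖w‖) ^ d)⁻¹)
        rw [mul_zero] at h3
        refine squeeze_zero_norm (fun m => (hRb m w).trans ?_) h3
        rw [one_div]
        exact mul_le_mul_of_nonneg_left (inv_anti₀ (by positivity)
          (le_add_of_nonneg_right (norm_nonneg w))) (by positivity)
      simpa using h1.add h2
  simp only [hzero] at hlim
  exact (tendsto_nhds_unique hlim tendsto_const_nhds)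

lemma integral_det_gradMatrix_congr {f g : Fin d → EuclideanSpace ℝ (Fin d) → ℝ}
    (hf : ∀ i, Tame (f i)) (hg : ∀ i, Tame (g i))
    (hfg : ∀ i, ∃ D, ∀ w, (1 + ‖w‖) * |f i w - g i w| ≤ D) :
    ∫ w, (gradMatrix f w).det = ∫ w, (gradMatrix g w).det := by
  suffices H : ∀ S : Finset (Fin d),
      ∫ w, (gradMatrix (S.piecewise g f) w).det = ∫ w, (gradMatrix f w).det by
    simpa using (H Finset.univ).symm
  intro S
  induction S using Finset.induction_on with
  | empty => simp
  | insert k S hkS ih =>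
    rw [← ih, Finset.piecewise_insert]
    set P := S.piecewise g f with hP
    have hPt : ∀ i, Tame (P i) := fun i => by
      by_cases hi : i ∈ S <;> simp [hP, hi, hf, hg]
    have hPk : P k = f k := by simp [hP, hkS]
    have hut : ∀ h, Tame h → ∀ i, Tame (Function.update P k h i) := fun h hh i => by
      by_cases hi : i = k
      · subst hi
        simpa using hh
      · simpa [hi] using hPt i
    have hsub := (hf k).sub (hg k)
    obtain ⟨D, hD⟩ := hfg k
    have h0 : ∫ w, (gradMatrix (Function.update P k fun w => f k w - g k w) w).det = 0 :=
      integral_det_gradMatrix_eq_zero (hut _ hsub) (k := k) (D := D) (by simpa using hD)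
    have hdet : ∀ w, (gradMatrix (Function.update P k fun w => f k w - g k w) w).det
        = (gradMatrix P w).det - (gradMatrix (Function.update P k (g k)) w).det := by
      intro w
      have hrow : gradMatrix P w k
          = (fun j => fderiv ℝ (fun w => f k w - g k w) w (EuclideanSpace.single j 1))
            + fun j => fderiv ℝ (g k) w (EuclideanSpace.single j 1) := by
        ext j
        rw [gradMatrix_apply, hPk, Pi.add_apply, fderiv_fun_sub
          ((hf k).contDiff.differentiable (by norm_num) w)
          ((hg k).contDiff.differentiable (by norm_num) w)]
        simp
      conv_rhs => rw [← Matrix.updateRow_eq_self (gradMatrix P w) k, hrow]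
      rw [Matrix.det_updateRow_add, gradMatrix_update, gradMatrix_update, add_sub_cancel_right]
    simp only [hdet] at h0
    rw [integral_sub (integrable_det_gradMatrix hPt)
      (integrable_det_gradMatrix (hut _ (hg k)))] at h0
    exact (sub_eq_zero.mp h0).symm

end Cutoff

section SmoothNorm

variable {d : ℕ} {ε : ℝ}

/-- The smoothed norm `√(‖w‖² + ε²)`. -/
noncomputable def smoothNorm (ε : ℝ) (w : EuclideanSpace ℝ (Fin d)) : ℝ := √(‖w‖ ^ 2 + ε ^ 2)

/-- The gradient of the smoothed norm, a smooth approximation of `unitHat`. -/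
noncomputable def smoothHat (ε : ℝ) (w : EuclideanSpace ℝ (Fin d)) : EuclideanSpace ℝ (Fin d) :=
  (smoothNorm ε w)⁻¹ • w

lemma smoothNorm_pos (hε : 0 < ε) (w : EuclideanSpace ℝ (Fin d)) : 0 < smoothNorm ε w :=
  Real.sqrt_pos.mpr (by positivity)

lemma smoothNorm_sq (ε : ℝ) (w : EuclideanSpace ℝ (Fin d)) :
    smoothNorm ε w ^ 2 = ‖w‖ ^ 2 + ε ^ 2 := Real.sq_sqrt (by positivity)

lemma norm_le_smoothNorm (ε : ℝ) (w : EuclideanSpace ℝ (Fin d)) : ‖w‖ ≤ smoothNorm ε w :=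
  Real.le_sqrt_of_sq_le (by nlinarith [sq_nonneg ε])

lemma le_smoothNorm (ε : ℝ) (w : EuclideanSpace ℝ (Fin d)) : ε ≤ smoothNorm ε w :=
  Real.le_sqrt_of_sq_le (by nlinarith [sq_nonneg ‖w‖])

lemma abs_smoothNorm_sub_le (hε : 0 < ε) (v w : EuclideanSpace ℝ (Fin d)) :
    |smoothNorm ε v - smoothNorm ε w| ≤ ‖v - w‖ := by
  have hv := smoothNorm_pos hε v
  have hw := smoothNorm_pos hε w
  have h : (smoothNorm ε v - smoothNorm ε w) * (smoothNorm ε v + smoothNorm ε w)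
      = (‖v‖ - ‖w‖) * (‖v‖ + ‖w‖) := by
    linear_combination smoothNorm_sq ε v - smoothNorm_sq ε w
  have h2 := congrArg abs h
  rw [abs_mul, abs_mul, abs_of_pos (add_pos hv hw),
    abs_of_nonneg (add_nonneg (norm_nonneg v) (norm_nonneg w))] at h2
  have h3 : ‖v‖ + ‖w‖ ≤ smoothNorm ε v + smoothNorm ε w :=
    add_le_add (norm_le_smoothNorm ε v) (norm_le_smoothNorm ε w)
  refine le_trans ?_ (abs_norm_sub_norm_le v w)
  refine le_of_mul_le_mul_right ?_ (add_pos hv hw)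
  rw [h2]
  exact mul_le_mul_of_nonneg_left h3 (abs_nonneg _)

lemma contDiff_smoothNorm (hε : 0 < ε) :
    ContDiff ℝ 2 (smoothNorm ε : EuclideanSpace ℝ (Fin d) → ℝ) :=
  ((contDiff_norm_sq ℝ).add contDiff_const).sqrt fun w => by positivity

lemma hasFDerivAt_smoothNorm (hε : 0 < ε) (w : EuclideanSpace ℝ (Fin d)) :
    HasFDerivAt (smoothNorm ε) (innerSL ℝ (smoothHat ε w)) w := by
  have h := ((hasStrictFDerivAt_norm_sq w).hasFDerivAt.add_const (ε ^ 2)).sqrt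
    (by positivity)
  refine h.congr_fderiv ?_
  rw [smoothHat, map_smul, ← Nat.cast_smul_eq_nsmul ℝ, smul_smul]
  congr 1
  rw [smoothNorm]
  push_cast
  field_simp

lemma norm_smoothHat_le_one (hε : 0 < ε) (w : EuclideanSpace ℝ (Fin d)) : ‖smoothHat ε w‖ ≤ 1 := by
  rw [smoothHat, norm_smul, norm_inv, Real.norm_eq_abs, abs_of_pos (smoothNorm_pos hε w),
    ← div_eq_inv_mul]
  exact div_le_one_of_le₀ (norm_le_smoothNorm ε w) (smoothNorm_pos hε w).le

lemma smoothHat_neg (ε : ℝ) (w : EuclideanSpace ℝ (Fin d)) :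
    smoothHat ε (-w) = -smoothHat ε w := by
  simp [smoothHat, smoothNorm]

lemma smoothNorm_mul_norm_smoothHat_sub_le (hε : 0 < ε) (w v : EuclideanSpace ℝ (Fin d)) :
    smoothNorm ε w * ‖smoothHat ε w - smoothHat ε v‖ ≤ 2 * ‖w - v‖ := by
  have hw := smoothNorm_pos hε w
  have hv := smoothNorm_pos hε v
  have h : smoothNorm ε w • (smoothHat ε w - smoothHat ε v)
      = (w - v) + (smoothNorm ε v - smoothNorm ε w) • smoothHat ε v := by
    simp only [smoothHat, smul_sub, sub_smul]
    rw [smul_inv_smul₀ hw.ne', smul_inv_smul₀ hv.ne']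
    abel
  rw [← abs_of_pos hw, ← Real.norm_eq_abs, ← norm_smul, h, two_mul]
  refine (norm_add_le _ _).trans (add_le_add le_rfl ?_)
  rw [norm_smul, Real.norm_eq_abs, abs_sub_comm]
  exact (mul_le_of_le_one_right (abs_nonneg _) (norm_smoothHat_le_one hε v)).trans
    (abs_smoothNorm_sub_le hε w v)

lemma norm_smoothHat_sub_bound (hε : 0 < ε) (a w : EuclideanSpace ℝ (Fin d)) :
    (1 + ‖w‖) * ‖smoothHat ε w - smoothHat ε (w - a)‖ ≤ 2 + 2 * ‖a‖ := by
  have h1 : ‖smoothHat ε w - smoothHat ε (w - a)‖ ≤ 2 :=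
    (norm_sub_le _ _).trans (by
      linarith [norm_smoothHat_le_one hε w, norm_smoothHat_le_one hε (w - a)])
  have h2 := smoothNorm_mul_norm_smoothHat_sub_le hε w (w - a)
  rw [sub_sub_cancel] at h2
  nlinarith [mul_le_mul_of_nonneg_right (norm_le_smoothNorm ε w)
    (norm_nonneg (smoothHat ε w - smoothHat ε (w - a)))]

lemma abs_inner_smoothHat_sub_bound (hε : 0 < ε) (hε1 : ε ≤ 1) (a w : EuclideanSpace ℝ (Fin d)) :
    (1 + ‖w‖) * |inner ℝ (smoothHat ε w - smoothHat ε (w - a)) w| ≤ 3 * ‖a‖ + 3 * ‖a‖ ^ 2 := by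
  set s := smoothNorm ε w with hs
  set s' := smoothNorm ε (w - a) with hs'
  have hs0 : 0 < s := smoothNorm_pos hε w
  have hs₀' : 0 < s' := smoothNorm_pos hε (w - a)
  set X := inner ℝ (smoothHat ε w - smoothHat ε (w - a)) w with hX
  have hss : |s - s'| ≤ ‖a‖ := by
    simpa using abs_smoothNorm_sub_le hε w (w - a)
  have hXle : |X| ≤ 2 * ‖a‖ := by
    have h2 := smoothNorm_mul_norm_smoothHat_sub_le hε w (w - a)
    rw [sub_sub_cancel] at h2
    refine (abs_real_inner_le_norm _ _).trans (le_trans ?_ h2)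
    rw [mul_comm]
    exact mul_le_mul_of_nonneg_right (norm_le_smoothNorm ε w) (norm_nonneg _)
  have hin : inner ℝ (w - a) w = (‖w‖ ^ 2 + ‖w - a‖ ^ 2 - ‖a‖ ^ 2) / 2 := by
    have := norm_sub_sq_real (w - a) w
    rw [sub_sub_cancel_left, norm_neg] at this
    linarith
  have hexact : s' * X = -(s - s') ^ 2 / 2 + ε ^ 2 / s * (s - s') + ‖a‖ ^ 2 / 2 := by
    have e1 : ‖w‖ ^ 2 = s ^ 2 - ε ^ 2 := by linarith [smoothNorm_sq ε w]
    have e2 : ‖w - a‖ ^ 2 = s' ^ 2 - ε ^ 2 := by linarith [smoothNorm_sq ε (w - a)]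
    simp only [hX, smoothHat, inner_sub_left (_ • _), real_inner_smul_left]
    rw [real_inner_self_eq_norm_sq, hin, e2, e1, ← hs, ← hs']
    field_simp
    ring
  have hεs : |ε ^ 2 / s * (s - s')| ≤ ‖a‖ := by
    rw [abs_mul, abs_of_pos (by positivity)]
    have : ε ^ 2 / s ≤ 1 := by
      rw [div_le_one hs0]
      nlinarith [le_smoothNorm ε w]
    exact (mul_le_of_le_one_left (abs_nonneg _) this).trans hss
  have hsq : (s - s') ^ 2 ≤ ‖a‖ ^ 2 := by
    rw [← sq_abs (s - s')]
    gcongr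
  have h1 : s' * |X| ≤ ‖a‖ + ‖a‖ ^ 2 := by
    have habs : s' * |X| = |s' * X| := by rw [abs_mul, abs_of_pos hs₀']
    rw [habs, hexact]
    have := abs_le.mp hεs
    rw [abs_le]
    constructor <;> nlinarith [sq_nonneg (s - s'), sq_nonneg ‖a‖]
  have h2 : ‖w‖ ≤ s' + ‖a‖ := by
    calc ‖w‖ = ‖(w - a) + a‖ := by rw [sub_add_cancel]
      _ ≤ ‖w - a‖ + ‖a‖ := norm_add_le _ _
      _ ≤ s' + ‖a‖ := by gcongr; exact norm_le_smoothNorm ε _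
  nlinarith [mul_le_mul_of_nonneg_right h2 (abs_nonneg X),
    mul_le_mul_of_nonneg_left hXle (norm_nonneg a)]

lemma hasFDerivAt_smoothNorm_sub (hε : 0 < ε) (a w : EuclideanSpace ℝ (Fin d)) :
    HasFDerivAt (fun w => smoothNorm ε w - smoothNorm ε (w - a))
      (innerSL ℝ (smoothHat ε w - smoothHat ε (w - a))) w := by
  rw [map_sub]
  have h := (hasFDerivAt_smoothNorm hε (w - a)).comp w ((hasFDerivAt_id w).sub_const a)
  rw [ContinuousLinearMap.comp_id] at h
  exact (hasFDerivAt_smoothNorm hε w).sub h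

lemma tame_smoothNorm_sub (hε : 0 < ε) (hε1 : ε ≤ 1) (a : EuclideanSpace ℝ (Fin d)) :
    Tame fun w => smoothNorm ε w - smoothNorm ε (w - a) := by
  refine ⟨(contDiff_smoothNorm hε).sub ((contDiff_smoothNorm hε).comp
    (contDiff_id.sub contDiff_const)), 2 + 3 * ‖a‖ + 3 * ‖a‖ ^ 2, fun w => ?_⟩
  rw [(hasFDerivAt_smoothNorm_sub hε a w).fderiv, innerSL_apply_norm, innerSL_apply_apply]
  exact ⟨(norm_smoothHat_sub_bound hε a w).trans (by nlinarith [norm_nonneg a]),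
    (abs_inner_smoothHat_sub_bound hε hε1 a w).trans (by linarith)⟩

lemma hasFDerivAt_smoothHat (hε : 0 < ε) (w : EuclideanSpace ℝ (Fin d)) :
    HasFDerivAt (smoothHat ε)
      ((smoothNorm ε w)⁻¹ • (ContinuousLinearMap.id ℝ (EuclideanSpace ℝ (Fin d)) -
        (innerSL ℝ (smoothHat ε w)).smulRight (smoothHat ε w))) w := by
  have hs := smoothNorm_pos hε w
  have h := ((hasDerivAt_inv hs.ne').comp_hasFDerivAt w (hasFDerivAt_smoothNorm hε w)).smul
    (hasFDerivAt_id w)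
  refine h.congr_fderiv ?_
  ext1 v
  simp only [smoothHat, smul_apply, sub_apply, add_apply, ContinuousLinearMap.id_apply,
    ContinuousLinearMap.smulRight_apply, innerSL_apply_apply, real_inner_smul_left,
    Function.comp_apply, id, smul_sub, smul_smul, smul_eq_mul]
  rw [sub_eq_add_neg, ← neg_smul]
  congr 2
  field_simp

lemma hasFDerivAt_inner_smoothHat (hε : 0 < ε) (c w : EuclideanSpace ℝ (Fin d)) :
    HasFDerivAt (fun w => inner ℝ c (smoothHat ε w))
      ((smoothNorm ε w)⁻¹ •
        innerSL ℝ (c - inner ℝ c (smoothHat ε w) • smoothHat ε w)) w := by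
  refine ((innerSL ℝ c).hasFDerivAt.comp w (hasFDerivAt_smoothHat hε w)).congr_fderiv ?_
  ext1 v
  simp only [smul_apply, innerSL_apply_apply, inner_sub_left, real_inner_smul_left,
    ContinuousLinearMap.comp_apply, sub_apply, ContinuousLinearMap.id_apply,
    ContinuousLinearMap.smulRight_apply, real_inner_smul_right, inner_sub_right, smul_eq_mul]
  ring

lemma one_add_norm_le (hε : 0 < ε) (w : EuclideanSpace ℝ (Fin d)) :
    1 + ‖w‖ ≤ (1 + ε⁻¹) * smoothNorm ε w := by
  have h : 1 ≤ ε⁻¹ * smoothNorm ε w := by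
    rw [← div_eq_inv_mul, le_div_iff₀ hε, one_mul]
    exact le_smoothNorm ε w
  linarith [norm_le_smoothNorm ε w]

lemma tame_inner_smoothHat (hε : 0 < ε) (c : EuclideanSpace ℝ (Fin d)) :
    Tame fun w => inner ℝ c (smoothHat ε w) := by
  have hcd : ContDiff ℝ 2 fun w : EuclideanSpace ℝ (Fin d) => inner ℝ c (smoothHat ε w) :=
    contDiff_const.inner ℝ (((contDiff_smoothNorm hε).inv fun w => (smoothNorm_pos hε w).ne').smul
      contDiff_id)
  refine ⟨hcd, (1 + ε⁻¹) * (2 * ‖c‖) + (1 + ε⁻¹) * (‖c‖ * ε), fun w => ?_⟩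
  have hs := smoothNorm_pos hε w
  have hu := norm_smoothHat_le_one hε w
  have hcu : |inner ℝ c (smoothHat ε w)| ≤ ‖c‖ :=
    (abs_real_inner_le_norm _ _).trans (mul_le_of_le_one_right (norm_nonneg _) hu)
  have hred : ∀ x : ℝ, 0 ≤ x → (1 + ‖w‖) * ((smoothNorm ε w)⁻¹ * x) ≤ (1 + ε⁻¹) * x := by
    intro x hx
    rw [← mul_assoc]
    refine mul_le_mul_of_nonneg_right ?_ hx
    rw [← div_eq_mul_inv, div_le_iff₀ hs]
    exact one_add_norm_le hε w
  rw [(hasFDerivAt_inner_smoothHat hε c w).fderiv, norm_smul, innerSL_apply_norm, norm_inv,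
    Real.norm_eq_abs, abs_of_pos hs, smul_apply, innerSL_apply_apply, smul_eq_mul, abs_mul,
    abs_inv, abs_of_pos hs]
  constructor
  · refine (hred _ (norm_nonneg _)).trans (le_trans ?_ (le_add_of_nonneg_right (by positivity)))
    gcongr
    refine (norm_sub_le _ _).trans ?_
    rw [two_mul, norm_smul, Real.norm_eq_abs]
    gcongr
    exact (mul_le_of_le_one_right (abs_nonneg _) hu).trans hcu
  · refine (hred _ (abs_nonneg _)).trans (le_trans ?_ (le_add_of_nonneg_left (by positivity)))
    gcongr
    have hw : w = smoothNorm ε w • smoothHat ε w := by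
      rw [smoothHat, smul_smul, mul_inv_cancel₀ hs.ne', one_smul]
    have h1 : inner ℝ (c - inner ℝ c (smoothHat ε w) • smoothHat ε w) w
        = inner ℝ c (smoothHat ε w) * (ε ^ 2 / smoothNorm ε w) := by
      have e1 : inner ℝ (smoothHat ε w) w = ‖w‖ ^ 2 / smoothNorm ε w := by
        rw [smoothHat, real_inner_smul_left, real_inner_self_eq_norm_sq]
        ring
      have e2 : inner ℝ c w = smoothNorm ε w * inner ℝ c (smoothHat ε w) := by
        conv_lhs => rw [hw]
        rw [real_inner_smul_right]
      rw [inner_sub_left, real_inner_smul_left, e1, e2]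
      field_simp
      linear_combination inner ℝ c (smoothHat ε w) * smoothNorm_sq ε w
    rw [h1, abs_mul, abs_of_pos (by positivity : 0 < ε ^ 2 / smoothNorm ε w)]
    have h2 : ε ^ 2 / smoothNorm ε w ≤ ε := by
      rw [div_le_iff₀ hs, sq]
      exact mul_le_mul_of_nonneg_left (le_smoothNorm ε w) hε.le
    gcongr

/-- The difference `s(w) - s(w - a)` agrees with its linearization up to `O(1 / ‖w‖)`. -/
lemma smoothNorm_sub_sub_inner_bound (hε : 0 < ε) (a w : EuclideanSpace ℝ (Fin d)) :
    (1 + ‖w‖) * |smoothNorm ε w - smoothNorm ε (w - a) - inner ℝ a (smoothHat ε w)|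
      ≤ (1 + ε⁻¹) * (2 * ‖a‖ ^ 2) := by
  set s := smoothNorm ε w with hs
  set s' := smoothNorm ε (w - a) with hs'
  have hs0 : 0 < s := smoothNorm_pos hε w
  have hs₀' : 0 < s' := smoothNorm_pos hε (w - a)
  set p := inner ℝ a (smoothHat ε w) with hp
  have hpa : |p| ≤ ‖a‖ := (abs_real_inner_le_norm _ _).trans
    (mul_le_of_le_one_right (norm_nonneg _) (norm_smoothHat_le_one hε w))
  have hss : |s - s'| ≤ ‖a‖ := by
    simpa using abs_smoothNorm_sub_le hε w (w - a)
  have haw : inner ℝ w a = s * p := by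
    rw [hp, smoothHat, real_inner_smul_right, real_inner_comm, ← mul_assoc, ← hs,
      mul_inv_cancel₀ hs0.ne', one_mul]
  have hkey : (s - s' - p) * (s + s') = p * (s - s') - ‖a‖ ^ 2 := by
    have h1 := norm_sub_sq_real w a
    rw [haw] at h1
    linear_combination smoothNorm_sq ε w - smoothNorm_sq ε (w - a) - h1
  have h2 : |s - s' - p| * s ≤ 2 * ‖a‖ ^ 2 := by
    calc |s - s' - p| * s ≤ |s - s' - p| * (s + s') := by gcongr; linarith
      _ = |p * (s - s') - ‖a‖ ^ 2| := by
          rw [← hkey, abs_mul, abs_of_pos (add_pos hs0 hs₀')]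
      _ ≤ |p| * |s - s'| + ‖a‖ ^ 2 := by
          refine (abs_sub _ _).trans ?_
          rw [abs_mul, abs_of_nonneg (sq_nonneg ‖a‖)]
      _ ≤ ‖a‖ * ‖a‖ + ‖a‖ ^ 2 := by gcongr
      _ = 2 * ‖a‖ ^ 2 := by ring
  calc (1 + ‖w‖) * |s - s' - p| ≤ ((1 + ε⁻¹) * s) * |s - s' - p| := by
        gcongr
        exact one_add_norm_le hε w
    _ = (1 + ε⁻¹) * (|s - s' - p| * s) := by ring
    _ ≤ (1 + ε⁻¹) * (2 * ‖a‖ ^ 2) := by gcongr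

lemma tendsto_smoothHat {e : ℕ → ℝ} (he : Filter.Tendsto e Filter.atTop (nhds 0))
    (v : EuclideanSpace ℝ (Fin d)) :
    Filter.Tendsto (fun m => smoothHat (e m) v) Filter.atTop (nhds (unitHat v)) := by
  by_cases hv : v = 0
  · simp [hv, smoothHat, unitHat]
  · rw [unitHat, if_neg hv]
    have h : Filter.Tendsto (fun m => √(‖v‖ ^ 2 + e m ^ 2)) Filter.atTop (nhds ‖v‖) := by
      have := ((he.pow 2).const_add (‖v‖ ^ 2)).sqrt
      simpa using this
    exact (h.inv₀ (norm_ne_zero_iff.mpr hv)).smul_const v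

end SmoothNorm

section Volume

variable {d : ℕ} {ε : ℝ}

lemma injective_smoothHat (hε : 0 < ε) :
    Function.Injective (smoothHat ε : EuclideanSpace ℝ (Fin d) → _) := by
  intro v w h
  have hu : ∀ w : EuclideanSpace ℝ (Fin d),
      smoothNorm ε w ^ 2 * (1 - ‖smoothHat ε w‖ ^ 2) = ε ^ 2 := by
    intro w
    have hs := smoothNorm_pos hε w
    rw [smoothHat, norm_smul, norm_inv, Real.norm_eq_abs, abs_of_pos hs]
    field_simp
    linarith [smoothNorm_sq ε w]
  have h1 : smoothNorm ε v = smoothNorm ε w := by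
    have hv := hu v
    have hw := hu w
    rw [h] at hv
    have hpos : 0 < 1 - ‖smoothHat ε w‖ ^ 2 :=
      pos_of_mul_pos_right (hw.symm ▸ pow_pos hε 2) (sq_nonneg (smoothNorm ε w))
    have h2 := mul_right_cancel₀ hpos.ne' (hv.trans hw.symm)
    exact (sq_eq_sq₀ (smoothNorm_pos hε v).le (smoothNorm_pos hε w).le).mp h2
  rw [smoothHat, smoothHat, h1] at h
  exact smul_right_injective _ (inv_ne_zero (smoothNorm_pos hε w).ne') h

lemma range_smoothHat (hε : 0 < ε) :
    Set.range (smoothHat ε : EuclideanSpace ℝ (Fin d) → _) = Metric.ball 0 1 := by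
  ext u
  rw [mem_ball_zero_iff]
  constructor
  · rintro ⟨w, rfl⟩
    have hs := smoothNorm_pos hε w
    rw [smoothHat, norm_smul, norm_inv, Real.norm_eq_abs, abs_of_pos hs, ← div_eq_inv_mul,
      div_lt_one hs]
    exact Real.lt_sqrt_of_sq_lt (by nlinarith)
  · intro hu
    have hpos : 0 < 1 - ‖u‖ ^ 2 := by nlinarith [norm_nonneg u]
    have hr := Real.sqrt_pos.mpr hpos
    have hr2 := Real.sq_sqrt hpos.le
    set r := √(1 - ‖u‖ ^ 2)
    have hs : smoothNorm ε ((ε / r) • u) = ε / r := by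
      rw [smoothNorm, Real.sqrt_eq_iff_eq_sq (by positivity) (by positivity), norm_smul,
        Real.norm_eq_abs, abs_of_pos (by positivity)]
      field_simp
      linarith
    refine ⟨(ε / r) • u, ?_⟩
    rw [smoothHat, hs, inv_smul_smul₀ (by positivity)]

/-- The Jacobian of `smoothHat`. -/
noncomputable def smoothHatDeriv (ε : ℝ) (w : EuclideanSpace ℝ (Fin d)) :
    EuclideanSpace ℝ (Fin d) →L[ℝ] EuclideanSpace ℝ (Fin d) :=
  (smoothNorm ε w)⁻¹ • (ContinuousLinearMap.id ℝ (EuclideanSpace ℝ (Fin d)) -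
    (innerSL ℝ (smoothHat ε w)).smulRight (smoothHat ε w))

lemma toMatrix_smoothHatDeriv (ε : ℝ) (w : EuclideanSpace ℝ (Fin d)) :
    LinearMap.toMatrix (EuclideanSpace.basisFun (Fin d) ℝ).toBasis
        (EuclideanSpace.basisFun (Fin d) ℝ).toBasis (smoothHatDeriv ε w).toLinearMap
      = (smoothNorm ε w)⁻¹ • (1 + Matrix.replicateCol Unit (-(smoothHat ε w).ofLp) *
        Matrix.replicateRow Unit (smoothHat ε w).ofLp) := by
  ext i j
  simp [LinearMap.toMatrix_apply, smoothHatDeriv, Matrix.mul_apply, Matrix.one_apply,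
    EuclideanSpace.inner_single_right]
  left
  ring

lemma det_smoothHatDeriv_nonneg (hε : 0 < ε) (w : EuclideanSpace ℝ (Fin d)) :
    0 ≤ (smoothHatDeriv ε w).det := by
  have hs := smoothNorm_pos hε w
  have hu := norm_smoothHat_le_one hε w
  rw [ContinuousLinearMap.det,
    ← LinearMap.det_toMatrix (EuclideanSpace.basisFun (Fin d) ℝ).toBasis,
    toMatrix_smoothHatDeriv, Matrix.det_smul, Matrix.det_one_add_replicateCol_mul_replicateRow]
  have h : (smoothHat ε w).ofLp ⬝ᵥ -(smoothHat ε w).ofLp = -‖smoothHat ε w‖ ^ 2 := by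
    rw [EuclideanSpace.real_norm_sq_eq]
    simp [dotProduct, sq]
  rw [h]
  have : 0 ≤ 1 + -‖smoothHat ε w‖ ^ 2 := by nlinarith [norm_nonneg (smoothHat ε w)]
  positivity

lemma integral_det_smoothHatDeriv (hε : 0 < ε) :
    ∫ w : EuclideanSpace ℝ (Fin d), (smoothHatDeriv ε w).det
      = volume.real (Metric.ball (0 : EuclideanSpace ℝ (Fin d)) 1) := by
  have h := integral_image_eq_integral_abs_det_fderiv_smul
    (volume : Measure (EuclideanSpace ℝ (Fin d))) MeasurableSet.univ
    (fun w _ => (hasFDerivAt_smoothHat hε w).hasFDerivWithinAt)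
    (injective_smoothHat hε).injOn (fun _ => (1 : ℝ))
  rw [Set.image_univ, range_smoothHat hε, setIntegral_const, setIntegral_univ, smul_eq_mul,
    mul_one] at h
  rw [h]
  refine integral_congr_ae (Filter.Eventually.of_forall fun w => ?_)
  simp only [smul_eq_mul, mul_one]
  exact (abs_of_nonneg (det_smoothHatDeriv_nonneg hε w)).symm

lemma gradMatrix_inner_smoothHat (hε : 0 < ε) (c : Fin d → EuclideanSpace ℝ (Fin d))
    (w : EuclideanSpace ℝ (Fin d)) :
    gradMatrix (fun i w => inner ℝ (c i) (smoothHat ε w)) w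
      = Matrix.of (fun i j => c i j) *
        LinearMap.toMatrix (EuclideanSpace.basisFun (Fin d) ℝ).toBasis
          (EuclideanSpace.basisFun (Fin d) ℝ).toBasis (smoothHatDeriv ε w).toLinearMap := by
  ext i j
  have h := ((innerSL ℝ (c i)).hasFDerivAt.comp w (hasFDerivAt_smoothHat hε w)).fderiv
  rw [gradMatrix_apply]
  refine (DFunLike.congr_fun h _).trans ?_
  change inner ℝ (c i) (smoothHatDeriv ε w (EuclideanSpace.single j 1)) = _
  simp only [Matrix.mul_apply, LinearMap.toMatrix_apply, PiLp.inner_apply]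
  simp [mul_comm]

lemma integral_det_gradMatrix_inner_smoothHat (hε : 0 < ε)
    (c : Fin d → EuclideanSpace ℝ (Fin d)) :
    ∫ w, (gradMatrix (fun i w => inner ℝ (c i) (smoothHat ε w)) w).det
      = (Matrix.of fun i j => c i j : Matrix (Fin d) (Fin d) ℝ).det *
        volume.real (Metric.ball (0 : EuclideanSpace ℝ (Fin d)) 1) := by
  simp only [gradMatrix_inner_smoothHat hε, Matrix.det_mul, LinearMap.det_toMatrix]
  rw [integral_const_mul, ← integral_det_smoothHatDeriv hε]

end Volume

section Limit

variable {d : ℕ} {ε : ℝ}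

lemma smoothHat_sub_sub_smoothHat_sub (ε : ℝ) (a b w : EuclideanSpace ℝ (Fin d)) :
    smoothHat ε (a - w) - smoothHat ε (b - w)
      = (smoothHat ε w - smoothHat ε (w - a)) - (smoothHat ε w - smoothHat ε (w - b)) := by
  rw [← neg_sub w a, ← neg_sub w b, smoothHat_neg, smoothHat_neg]
  abel

lemma integral_det_smoothHat_sub (hε : 0 < ε) (hε1 : ε ≤ 1)
    (a b : Fin d → EuclideanSpace ℝ (Fin d)) :
    ∫ w : EuclideanSpace ℝ (Fin d),
      (Matrix.of fun i j => (smoothHat ε (a i - w) - smoothHat ε (b i - w)) j :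
        Matrix (Fin d) (Fin d) ℝ).det
      = (Matrix.of fun i j => (a i - b i) j : Matrix (Fin d) (Fin d) ℝ).det *
        volume.real (Metric.ball (0 : EuclideanSpace ℝ (Fin d)) 1) := by
  rw [← integral_det_gradMatrix_inner_smoothHat hε,
    ← integral_det_gradMatrix_congr
      (fun i => (tame_smoothNorm_sub hε hε1 (a i)).sub (tame_smoothNorm_sub hε hε1 (b i)))
      (fun i => tame_inner_smoothHat hε (a i - b i)) fun i =>
        ⟨(1 + ε⁻¹) * (2 * ‖a i‖ ^ 2) + (1 + ε⁻¹) * (2 * ‖b i‖ ^ 2), fun w => ?_⟩]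
  · refine integral_congr_ae (Filter.Eventually.of_forall fun w => ?_)
    refine congrArg Matrix.det (Matrix.ext fun i j => ?_)
    rw [gradMatrix_apply, ((hasFDerivAt_smoothNorm_sub hε (a i) w).fun_sub
      (hasFDerivAt_smoothNorm_sub hε (b i) w)).fderiv, Matrix.of_apply,
      smoothHat_sub_sub_smoothHat_sub, ← map_sub, innerSL_apply_apply,
      EuclideanSpace.inner_single_right]
    simp
  · refine le_trans ?_ (add_le_add (smoothNorm_sub_sub_inner_bound hε (a i) w)
      (smoothNorm_sub_sub_inner_bound hε (b i) w))
    rw [← mul_add]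
    refine mul_le_mul_of_nonneg_left (le_trans (le_of_eq ?_) (abs_sub _ _)) (by positivity)
    rw [inner_sub_left]
    congr 1
    ring

lemma exists_pow_mul_abs_det_smoothHat_sub_le (a b : Fin d → EuclideanSpace ℝ (Fin d)) :
    ∃ K, ∀ ε : ℝ, 0 < ε → ε ≤ 1 → ∀ w : EuclideanSpace ℝ (Fin d),
      (1 + ‖w‖) ^ (d + 1) *
        |(Matrix.of fun i j => (smoothHat ε (a i - w) - smoothHat ε (b i - w)) j :
          Matrix (Fin d) (Fin d) ℝ).det| ≤ K := by
  set c : EuclideanSpace ℝ (Fin d) → ℝ := fun v => 2 + 3 * ‖v‖ + 3 * ‖v‖ ^ 2 with hc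
  have hc0 : ∀ v, 0 ≤ c v := fun v => by positivity
  set K : ℝ := 1 + ∑ i, (c (a i) + c (b i)) with hKdef
  have hle : ∀ i, c (a i) + c (b i) ≤ K := fun i =>
    (Finset.single_le_sum (f := fun i => c (a i) + c (b i))
      (fun i _ => add_nonneg (hc0 _) (hc0 _)) (Finset.mem_univ i)).trans (by simp [hKdef])
  have hK : 1 ≤ K := le_add_of_nonneg_right
    (Finset.sum_nonneg fun i _ => add_nonneg (hc0 _) (hc0 _))
  refine ⟨_, fun ε hε hε1 w => pow_mul_abs_det_le hK (fun i j => ?_) (fun i => ?_)⟩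
  · refine le_trans ?_ (hle i)
    rw [Matrix.of_apply, smoothHat_sub_sub_smoothHat_sub]
    refine le_trans ?_ (add_le_add
      ((norm_smoothHat_sub_bound hε (a i) w).trans (?_ : _ ≤ c (a i)))
      ((norm_smoothHat_sub_bound hε (b i) w).trans (?_ : _ ≤ c (b i))))
    · rw [← mul_add]
      exact mul_le_mul_of_nonneg_left ((Real.norm_eq_abs _).symm.le.trans
        ((PiLp.norm_apply_le _ j).trans (norm_sub_le _ _))) (by positivity)
    all_goals
      simp only [hc]
      nlinarith [norm_nonneg (a i), norm_nonneg (b i)]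
  · refine le_trans ?_ (hle i)
    have hrow : (Matrix.of fun i j => (smoothHat ε (a i - w) - smoothHat ε (b i - w)) j :
        Matrix (Fin d) (Fin d) ℝ).mulVec w.ofLp i
          = inner ℝ (smoothHat ε (a i - w) - smoothHat ε (b i - w)) w := by
      simp [Matrix.mulVec, dotProduct, PiLp.inner_apply, mul_comm]
    rw [hrow, smoothHat_sub_sub_smoothHat_sub, inner_sub_left]
    refine le_trans ?_ (add_le_add
      ((abs_inner_smoothHat_sub_bound hε hε1 (a i) w).trans (?_ : _ ≤ c (a i)))
      ((abs_inner_smoothHat_sub_bound hε hε1 (b i) w).trans (?_ : _ ≤ c (b i))))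
    · rw [← mul_add]
      exact mul_le_mul_of_nonneg_left (abs_sub _ _) (by positivity)
    all_goals
      simp only [hc]
      linarith

lemma continuous_smoothHat (hε : 0 < ε) :
    Continuous (smoothHat ε : EuclideanSpace ℝ (Fin d) → _) :=
  continuous_iff_continuousAt.mpr fun w => (hasFDerivAt_smoothHat hε w).continuousAt

/-- The signed volume swept out by differences of unit vectors: the integral of
`det ((a_i - w)^ - (b_i - w)^)` is `det (a_i - b_i)` times the volume of the unit ball. -/
theorem integrable_det_unitHat_sub_and_integral_eq (a b : Fin d → EuclideanSpace ℝ (Fin d)) :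
    Integrable (fun w : EuclideanSpace ℝ (Fin d) =>
      (Matrix.of fun i j => (unitHat (a i - w) - unitHat (b i - w)) j :
      Matrix (Fin d) (Fin d) ℝ).det) ∧
    ∫ w : EuclideanSpace ℝ (Fin d),
      (Matrix.of fun i j => (unitHat (a i - w) - unitHat (b i - w)) j :
        Matrix (Fin d) (Fin d) ℝ).det
      = (Matrix.of fun i j => (a i - b i) j : Matrix (Fin d) (Fin d) ℝ).det *
        volume.real (Metric.ball (0 : EuclideanSpace ℝ (Fin d)) 1) := by
  obtain ⟨K, hK⟩ := exists_pow_mul_abs_det_smoothHat_sub_le a b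
  set e : ℕ → ℝ := fun m => 1 / ((m : ℝ) + 1) with he
  have he0 : ∀ m, 0 < e m := fun m => by positivity
  have he1 : ∀ m, e m ≤ 1 := fun m => by
    rw [he, div_le_one (by positivity)]
    simp
  set F : ℕ → EuclideanSpace ℝ (Fin d) → ℝ := fun m w =>
    (Matrix.of fun i j => (smoothHat (e m) (a i - w) - smoothHat (e m) (b i - w)) j :
      Matrix (Fin d) (Fin d) ℝ).det with hF
  have hmeas : ∀ m, AEStronglyMeasurable (F m) volume := fun m => by
    refine (Continuous.matrix_det (continuous_matrix fun i j => ?_)).aestronglyMeasurable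
    have h := continuous_smoothHat (d := d) (he0 m)
    simp only [Matrix.of_apply]
    fun_prop
  have hbound : ∀ m, ∀ᵐ w, ‖F m w‖ ≤ K * ((1 + ‖w‖) ^ (d + 1))⁻¹ := fun m =>
    Filter.Eventually.of_forall fun w => by
      rw [← div_eq_mul_inv, le_div_iff₀ (by positivity), mul_comm]
      exact hK _ (he0 m) (he1 m) w
  have hlim : ∀ᵐ w, Filter.Tendsto (fun m => F m w) Filter.atTop
      (nhds (Matrix.of fun i j => (unitHat (a i - w) - unitHat (b i - w)) j :
        Matrix (Fin d) (Fin d) ℝ).det) :=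
    Filter.Eventually.of_forall fun w => by
      refine ((Continuous.matrix_det continuous_id).tendsto _).comp
        (tendsto_pi_nhds.mpr fun i => tendsto_pi_nhds.mpr fun j => ?_)
      have h := (tendsto_smoothHat tendsto_one_div_add_atTop_nhds_zero_nat (a i - w)).sub
        (tendsto_smoothHat tendsto_one_div_add_atTop_nhds_zero_nat (b i - w))
      exact ((EuclideanSpace.proj (𝕜 := ℝ) j).continuous.tendsto _).comp h
  have hint := (integrable_inv_one_add_norm_pow (d := d)).const_mul K
  refine ⟨⟨aestronglyMeasurable_of_tendsto_ae _ hmeas hlim,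
    hasFiniteIntegral_of_dominated_convergence hint.2 hbound hlim⟩,
    tendsto_nhds_unique (tendsto_integral_of_dominated_convergence _ hmeas hint hbound hlim) ?_⟩
  simp only [hF, integral_det_smoothHat_sub (he0 _) (he1 _)]
  exact tendsto_const_nhds

end Limit

section Assembly

variable {d : ℕ}

lemma det_sub_succ_eq (y : Fin (d + 1) → EuclideanSpace ℝ (Fin d)) (hy : y (Fin.last d) = 0) :
    (Matrix.of fun i j => (y i.castSucc - y i.succ) j : Matrix (Fin d) (Fin d) ℝ).det
      = (Matrix.of fun i j => y i.castSucc j : Matrix (Fin d) (Fin d) ℝ).det := by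
  set U : Matrix (Fin d) (Fin d) ℝ := Matrix.of fun i k =>
    (if i = k then 1 else 0) - (if (k : ℕ) = i + 1 then 1 else 0) with hU
  have hU1 : U.det = 1 := by
    rw [Matrix.det_of_isUpperTriangular]
    · simp [hU]
    · intro i k hik
      have hik : k < i := hik
      have h : (k : ℕ) ≠ i + 1 := by omega
      simp [hU, hik.ne', h]
  have hmul : (Matrix.of fun i j => (y i.castSucc - y i.succ) j : Matrix (Fin d) (Fin d) ℝ)
      = U * Matrix.of fun i j => y i.castSucc j := by
    ext i j
    have hsucc : ∑ k : Fin d, (if (k : ℕ) = i + 1 then y k.castSucc j else 0) = y i.succ j := by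
      by_cases hi : (i : ℕ) + 1 < d
      · rw [Finset.sum_eq_single ⟨i + 1, hi⟩ (fun k _ hk => if_neg fun h => hk (Fin.ext h))
          (by simp)]
        rw [if_pos rfl]
        rfl
      · have hlast : i.succ = Fin.last d := Fin.ext (by simp; omega)
        rw [hlast, hy]
        exact Finset.sum_eq_zero fun k _ => if_neg (by omega)
    simp [hU, Matrix.mul_apply, sub_mul, Finset.sum_sub_distrib, hsucc]
  rw [hmul, Matrix.det_mul, hU1, one_mul]

lemma two_I_pow_mul_volume_ball (hd : 0 < d) (hdeven : Even d) :
    (2 * Complex.I) ^ (d / 2) *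
      ((volume.real (Metric.ball (0 : EuclideanSpace ℝ (Fin d)) 1) : ℝ) : ℂ) = LambdaD d := by
  have : Nonempty (Fin d) := ⟨⟨0, hd⟩⟩
  have hvol : volume.real (Metric.ball (0 : EuclideanSpace ℝ (Fin d)) 1)
      = Real.pi ^ (d / 2) / (d / 2).factorial := by
    rw [measureReal_def, InnerProductSpace.volume_ball_of_dim_even (k := d / 2)
      (by rw [finrank_euclideanSpace_fin, Nat.two_mul_div_two_of_even hdeven])]
    simp only [ENNReal.ofReal_one, one_pow, one_mul]
    exact ENNReal.toReal_ofReal (by positivity)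
  rw [hvol, LambdaD, mul_pow _ (Real.pi : ℂ)]
  push_cast
  ring

end Assembly

/-- the continuum geometric identity
`∫_{ℝ^d} tr(γ₀ ∏ γ·((y_i − w)^ − (y_{i+1} − w)^)) dw = Λ_d Σ_λ sgn(λ) ∏ (y_i)_{λ_i}`,
together with the integrability of the integrand. -/
theorem clifford_geometric_identity_continuum {d n : ℕ} (hd : 0 < d) (hdeven : Even d)
    (hn : n = 2 ^ (d / 2))
    (γ : Fin d → Matrix (Fin n) (Fin n) ℂ)
    (hγ : ∀ i j, γ i * γ j + γ j * γ i = (if i = j then (2 : ℂ) else 0) • 1)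
    (y : Fin (d + 1) → EuclideanSpace ℝ (Fin d)) (hy : y (Fin.last d) = 0) :
    Integrable (fun w => cliffordIntegrand γ y w) volume ∧
    ∫ w, cliffordIntegrand γ y w =
      LambdaD d * ∑ σ : Equiv.Perm (Fin d),
        ((Equiv.Perm.sign σ : ℤ) : ℂ) * ∏ i : Fin d, ((y i.castSucc (σ i) : ℝ) : ℂ) := by
  have key : ∀ w, cliffordIntegrand γ y w = (2 * Complex.I) ^ (d / 2) *
      (((Matrix.of fun i j => (unitHat (y i.castSucc - w) - unitHat (y i.succ - w)) j :
        Matrix (Fin d) (Fin d) ℝ).det : ℝ) : ℂ) := fun w =>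
    trace_gammaZero_mul_prod_gammaDot hγ hdeven hn _
  obtain ⟨hint, heq⟩ := integrable_det_unitHat_sub_and_integral_eq
    (fun i : Fin d => y i.castSucc) (fun i => y i.succ)
  simp only [key]
  refine ⟨hint.ofReal.const_mul _, ?_⟩
  rw [integral_const_mul, integral_complex_ofReal, heq, det_sub_succ_eq y hy, Complex.ofReal_mul,
    mul_left_comm, two_I_pow_mul_volume_ball hd hdeven, mul_comm, ← Matrix.det_transpose,
    Matrix.det_apply']
  simp
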